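/- Let (X₁,μ₁),…,(Xₙ,μₙ) be σ-finite measure spaces with product (X,μ), let p₁ ≥ p₂ ≥ ⋯ ≥ pₙ be exponents in (0,∞], and let P be the double n-tuple pairing pⱼ with xⱼ. Let P₁,…,P_m enumerate the orbit {P_σ : σ ∈ Sₙ} of P under permutations of the variables, and let p̄ = (n⁻¹ Σ_{j=1}^n pⱼ⁻¹)⁻¹. Then for every nonnegative measurable function f on X, ‖f‖_{L^{p̄}(X)} ≤ ∏_{i=1}^m ‖f‖_{Pᵢ}^{1/m}. (The L^{p̄} norm of f is at most the geometric mean of its symmetric mixed norms.) -/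

import Mathlib

open MeasureTheory
open scoped ENNReal

/-- Take the `L^q` norm of `f` in the single variable `x_j`, with the convention that
an exponent `∞` is interpreted as the essential supremum in that variable. -/
noncomputable def normIn {n : ℕ} {X : Fin n → Type*} [∀ j, MeasurableSpace (X j)]
    (μ : ∀ j, Measure (X j)) (j : Fin n) (q : ℝ≥0∞)
    (f : (∀ k, X k) → ℝ≥0∞) : (∀ k, X k) → ℝ≥0∞ :=
  fun x =>
    if q = ∞ then essSup (fun t => f (Function.update x j t)) (μ j)
    else (∫⁻ t, f (Function.update x j t) ^ q.toReal ∂(μ j)) ^ (1 / q.toReal)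

/-- The mixed norm of `f` determined by a double `n`-tuple, given as the list of
(variable, exponent) pairs in the order of processing. -/
noncomputable def mixedNorm {n : ℕ} {X : Fin n → Type*} [∀ j, MeasurableSpace (X j)]
    (μ : ∀ j, Measure (X j)) (P : List (Fin n × ℝ≥0∞))
    (f : (∀ k, X k) → ℝ≥0∞) : ℝ≥0∞ :=
  ⨆ x, (P.foldl (fun g jq => normIn μ jq.1 jq.2 g) f) x

/-- The `L^p` "norm" (for `0 < p ≤ ∞`) of a nonnegative function, the exponent `∞`
being interpreted as the essential supremum. -/
noncomputable def eNorm {α : Type*} [MeasurableSpace α] (μ : Measure α) (p : ℝ≥0∞)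
    (g : α → ℝ≥0∞) : ℝ≥0∞ :=
  if p = ∞ then essSup g μ else (∫⁻ a, g a ^ p.toReal ∂μ) ^ (1 / p.toReal)

section TwoVar
variable {α β : Type*} [MeasurableSpace α] [MeasurableSpace β]

lemma normIn_eq_eNorm {n : ℕ} {X : Fin n → Type*} [∀ j, MeasurableSpace (X j)]
    (μ : ∀ j, Measure (X j)) (j : Fin n) (q : ℝ≥0∞)
    (f : (∀ k, X k) → ℝ≥0∞) (x : ∀ k, X k) :
    normIn μ j q f x = eNorm (μ j) q (fun t => f (Function.update x j t)) := rfl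

lemma eNorm_mono_ae {ν : Measure β} {q : ℝ≥0∞} {g h : β → ℝ≥0∞} (H : g ≤ᵐ[ν] h) :
    eNorm ν q g ≤ eNorm ν q h := by
  unfold eNorm
  split_ifs with hq
  · exact essSup_mono_ae H
  · refine ENNReal.rpow_le_rpow (lintegral_mono_ae ?_) (by positivity)
    filter_upwards [H] with x hx
    exact ENNReal.rpow_le_rpow hx (by positivity)

lemma measurable_eNorm {ν : Measure β} [SigmaFinite ν] (q : ℝ≥0∞) {F : α → β → ℝ≥0∞}
    (hF : Measurable (Function.uncurry F)) : Measurable (fun x => eNorm ν q (F x)) := by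
  unfold eNorm
  split_ifs with hq
  · refine measurable_of_Iic fun a => ?_
    have : (fun x => essSup (F x) ν) ⁻¹' Set.Iic a
        = {x | ν (Prod.mk x ⁻¹' {z : α × β | a < Function.uncurry F z}) = 0} := by
      ext x
      simp only [Set.mem_preimage, Set.mem_Iic, Set.mem_ofPred_eq, Set.preimage_ofPred_eq,
        Function.uncurry]
      constructor
      · intro h
        have h1 : ∀ᵐ t ∂ν, F x t ≤ a := by
          filter_upwards [ENNReal.ae_le_essSup (F x)] with t ht using ht.trans h
        rw [ae_iff] at h1
        simpa using h1
      · intro h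
        refine essSup_le_of_ae_le a ?_
        change ∀ᵐ t ∂ν, F x t ≤ a
        rw [ae_iff]
        simpa using h
    rw [this]
    exact measurable_measure_prodMk_left (measurableSet_lt measurable_const hF)
      (measurableSet_singleton 0)
  · exact (Measurable.lintegral_prod_right (hF.pow_const _)).pow_const _

lemma minkowski_aux {μ : Measure α} {ν : Measure β} [SigmaFinite μ] [SigmaFinite ν]
    {F : α → β → ℝ≥0∞} (hF : Measurable (Function.uncurry F)) {s t : ℝ}
    (hst : s.HolderConjugate t) {g : α → ℝ≥0∞} (hg : Measurable g)
    (hgG : ∀ x, g x ≤ ∫⁻ y, F x y ∂ν) (hfin : ∫⁻ x, g x ^ s ∂μ ≠ ∞) :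
    (∫⁻ x, g x ^ s ∂μ) ≤ (∫⁻ y, (∫⁻ x, F x y ^ s ∂μ) ^ (1 / s) ∂ν) ^ s := by
  set A := ∫⁻ x, g x ^ s ∂μ with hA
  set R := ∫⁻ y, (∫⁻ x, F x y ^ s ∂μ) ^ (1 / s) ∂ν with hR
  have hs := hst.pos
  have ht := hst.symm.pos
  have hs1 : 0 < s - 1 := by linarith [hst.lt]
  have hst' : (s - 1) * t = s := hst.sub_one_mul_conj
  have hF1 : ∀ x, Measurable (F x) := fun x => hF.of_uncurry_left
  have hF2 : ∀ y, Measurable (fun x => F x y) := fun y => hF.of_uncurry_right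
  have key : A ≤ R * A ^ (1 / t) := by
    calc A ≤ ∫⁻ x, g x ^ (s - 1) * ∫⁻ y, F x y ∂ν ∂μ := by
          refine lintegral_mono fun x => ?_
          calc g x ^ s = g x ^ ((s - 1) + 1) := by ring_nf
            _ = g x ^ (s - 1) * g x := by
              rw [ENNReal.rpow_add_of_nonneg _ _ hs1.le zero_le_one, ENNReal.rpow_one]
            _ ≤ _ := by gcongr; exact hgG x
      _ = ∫⁻ x, ∫⁻ y, g x ^ (s - 1) * F x y ∂ν ∂μ := by
          refine lintegral_congr fun x => ?_
          rw [lintegral_const_mul _ (hF1 x)]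
      _ = ∫⁻ y, ∫⁻ x, g x ^ (s - 1) * F x y ∂μ ∂ν := by
          refine lintegral_lintegral_swap ?_
          exact (((hg.comp measurable_fst).pow_const _).mul hF).aemeasurable
      _ ≤ ∫⁻ y, (∫⁻ x, F x y ^ s ∂μ) ^ (1 / s) * A ^ (1 / t) ∂ν := by
          refine lintegral_mono fun y => ?_
          have := ENNReal.lintegral_mul_le_Lp_mul_Lq μ hst (hF2 y).aemeasurable
            (hg.pow_const (s - 1)).aemeasurable
          simp only [Pi.mul_apply, ← ENNReal.rpow_mul, hst'] at this
          simpa only [mul_comm (g _ ^ (s - 1))] using this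
      _ = R * A ^ (1 / t) := by
          rw [lintegral_mul_const]
          exact (Measurable.lintegral_prod_left (hF.pow_const s)).pow_const _
  by_cases h0 : A = 0
  · rw [h0]; exact zero_le
  have h1 : A ^ (1 / s) * A ^ (1 / t) ≤ R * A ^ (1 / t) := by
    rw [← ENNReal.rpow_add _ _ h0 hfin, one_div, one_div, hst.inv_add_inv_eq_one,
      ENNReal.rpow_one]
    simpa using key
  have h2 : A ^ (1 / s) ≤ R := by
    refine (ENNReal.mul_le_mul_iff_left ?_ ?_).1 h1
    · simp [h0, hfin]
    · exact ENNReal.rpow_ne_top_of_nonneg (by positivity) hfin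
  calc A = (A ^ (1 / s)) ^ s := by
        rw [← ENNReal.rpow_mul, one_div, inv_mul_cancel₀ hs.ne', ENNReal.rpow_one]
    _ ≤ R ^ s := ENNReal.rpow_le_rpow h2 hs.le

lemma minkowski_lintegral {μ : Measure α} {ν : Measure β} [SigmaFinite μ] [SigmaFinite ν]
    {F : α → β → ℝ≥0∞} (hF : Measurable (Function.uncurry F)) {s : ℝ} (hs : 1 ≤ s) :
    (∫⁻ x, (∫⁻ y, F x y ∂ν) ^ s ∂μ) ≤ (∫⁻ y, (∫⁻ x, F x y ^ s ∂μ) ^ (1 / s) ∂ν) ^ s := by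
  rcases hs.eq_or_lt with rfl | hs
  · simpa using (lintegral_lintegral_swap hF.aemeasurable).le
  have hst := Real.HolderConjugate.conjExponent hs
  set G : α → ℝ≥0∞ := fun x => ∫⁻ y, F x y ∂ν with hG
  have hGm : Measurable G := Measurable.lintegral_prod_right hF
  have hs0 : 0 < s := by linarith
  let g : ℕ → α → ℝ≥0∞ := fun k => (spanningSets μ k).indicator (fun x => min (G x) k)
  have hgm : ∀ k, Measurable (g k) := fun k =>
    (hGm.min measurable_const).indicator (measurableSet_spanningSets μ k)
  have hgG : ∀ k x, g k x ≤ G x := fun k x => by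
    refine (Set.indicator_le_self _ _ x).trans (min_le_left _ _)
  have hmono : Monotone g := by
    intro k l hkl x
    simp only [g, Set.indicator]
    split_ifs with h1 h2
    · exact min_le_min le_rfl (by exact_mod_cast hkl)
    · exact absurd (monotone_spanningSets μ hkl h1) h2
    · exact zero_le
    · exact le_rfl
  have hsup : ∀ x, ⨆ k, g k x ^ s = G x ^ s := by
    intro x
    have h1 : ⨆ k, g k x = G x := by
      refine le_antisymm (iSup_le fun k => hgG k x) (le_of_forall_lt fun b hb => ?_)
      obtain ⟨k, hk⟩ := ENNReal.exists_nat_gt hb.ne_top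
      have hx := mem_spanningSetsIndex μ x
      refine lt_iSup_iff.2 ⟨max k (spanningSetsIndex μ x), ?_⟩
      have hx' : x ∈ spanningSets μ (max k (spanningSetsIndex μ x)) :=
        monotone_spanningSets μ (le_max_right _ _) hx
      simp only [g, Set.indicator_of_mem hx']
      refine lt_min hb (hk.trans_le ?_)
      exact_mod_cast le_max_left _ _
    rw [← h1]
    exact ((ENNReal.orderIsoRpow s hs0).map_iSup (fun k => g k x)).symm
  have hlim : ∫⁻ x, G x ^ s ∂μ = ⨆ k, ∫⁻ x, g k x ^ s ∂μ := by
    rw [← lintegral_iSup (fun k => (hgm k).pow_const s)]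
    · simp_rw [hsup]
    · intro k l hkl x
      exact ENNReal.rpow_le_rpow (hmono hkl x) hs0.le
  rw [hlim]
  refine iSup_le fun k => minkowski_aux hF hst (hgm k) (hgG k) ?_
  refine ne_top_of_le_ne_top (b := (k : ℝ≥0∞) ^ s * μ (spanningSets μ k)) ?_ ?_
  · refine ENNReal.mul_ne_top ?_ (measure_spanningSets_lt_top μ k).ne
    exact ENNReal.rpow_ne_top_of_nonneg hs0.le (by simp)
  · rw [← lintegral_indicator_const (measurableSet_spanningSets μ k)]
    refine lintegral_mono fun x => ?_
    simp only [g, Set.indicator]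
    split_ifs with h
    · exact ENNReal.rpow_le_rpow (min_le_right _ _) hs0.le
    · simp [hs0]

/-- Minkowski: taking the norm with the larger exponent `p` first is larger. -/
lemma eNorm_swap {μ : Measure α} {ν : Measure β} [SigmaFinite μ] [SigmaFinite ν]
    {F : α → β → ℝ≥0∞} (hF : Measurable (Function.uncurry F)) {p q : ℝ≥0∞} (hq : 0 < q)
    (hqp : q ≤ p) :
    eNorm μ p (fun x => eNorm ν q (fun y => F x y)) ≤
      eNorm ν q (fun y => eNorm μ p (fun x => F x y)) := by
  have hF' : Measurable (Function.uncurry (fun y x => F x y)) := hF.comp measurable_swap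
  by_cases hp : p = ∞
  · subst hp
    have hm := measurable_eNorm (ν := μ) ∞ hF'
    have h1 : ∀ᵐ y ∂ν, ∀ᵐ x ∂μ, F x y ≤ eNorm μ ∞ (fun x => F x y) := by
      refine Filter.Eventually.of_forall fun y => ?_
      simp only [eNorm, if_true]
      exact ENNReal.ae_le_essSup _
    replace h1 := (Measure.ae_ae_comm (p := fun y x => F x y ≤ eNorm μ ∞ (fun x => F x y))
      (measurableSet_le hF' (hm.comp measurable_fst))).1 h1
    conv_lhs => rw [eNorm, if_pos rfl]
    refine essSup_le_of_ae_le _ ?_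
    filter_upwards [h1] with x hx
    exact eNorm_mono_ae hx
  · have hq' : q ≠ ∞ := ne_top_of_le_ne_top hp hqp
    have ha : 0 < q.toReal := ENNReal.toReal_pos hq.ne' hq'
    have hab : q.toReal ≤ p.toReal := ENNReal.toReal_mono hp hqp
    simp only [eNorm, if_neg hp, if_neg hq']
    set a := q.toReal
    set b := p.toReal
    have hb : 0 < b := ha.trans_le hab
    have := minkowski_lintegral (μ := μ) (ν := ν) (F := fun x y => F x y ^ a) (hF.pow_const a) (s := b / a)
      ((one_le_div ha).2 hab)
    have h2 := ENNReal.rpow_le_rpow this (z := 1 / b) (by positivity)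
    have e1 : ∀ z : ℝ≥0∞, (z ^ (1 / a)) ^ b = z ^ (b / a) := fun z => by
      rw [← ENNReal.rpow_mul]; congr 1; field_simp
    have e2 : ∀ z : ℝ≥0∞, (z ^ a) ^ (b / a) = z ^ b := fun z => by
      rw [← ENNReal.rpow_mul]; congr 1; field_simp
    have e3 : ∀ z : ℝ≥0∞, (z ^ (1 / b)) ^ a = z ^ (1 / (b / a)) := fun z => by
      rw [← ENNReal.rpow_mul]; congr 1; field_simp
    have e4 : ∀ z : ℝ≥0∞, (z ^ (b / a)) ^ (1 / b) = z ^ (1 / a) := fun z => by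
      rw [← ENNReal.rpow_mul]; congr 1; field_simp
    simp only [Function.uncurry, e1, e2, e3, e4] at h2 ⊢
    exact h2

/-- Hölder. -/
lemma eNorm_holder {ι : Type*} [Fintype ι] {ν : Measure β} {r : ℝ≥0∞} {q : ι → ℝ≥0∞} {w : ℝ}
    (hw : 0 < w) (hq : ∀ i, 0 < q i) (hr0 : 0 < r)
    (hr : r⁻¹ = ∑ i, ENNReal.ofReal w * (q i)⁻¹)
    {g : ι → β → ℝ≥0∞} (hg : ∀ i, Measurable (g i)) :
    eNorm ν r (fun y => ∏ i, g i y ^ w) ≤ ∏ i, eNorm ν (q i) (g i) ^ w := by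
  classical
  by_cases hrt : r = ∞
  · have hqt : ∀ i, q i = ∞ := by
      intro i
      rw [hrt, ENNReal.inv_top, eq_comm, Finset.sum_eq_zero_iff] at hr
      have := hr i (Finset.mem_univ i)
      simpa [hw.not_ge] using this
    simp only [eNorm, hrt, hqt, if_true]
    refine essSup_le_of_ae_le _ ?_
    have : ∀ᵐ y ∂ν, ∀ i, g i y ≤ essSup (g i) ν :=
      ae_all_iff.2 fun i => ENNReal.ae_le_essSup _
    filter_upwards [this] with y hy
    exact Finset.prod_le_prod' fun i _ => ENNReal.rpow_le_rpow (hy i) hw.le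
  set ρ := r.toReal with hρ
  have hρ0 : 0 < ρ := ENNReal.toReal_pos hr0.ne' hrt
  set S : Finset ι := Finset.univ.filter (fun i => q i ≠ ∞) with hS
  have hqS : ∀ i ∈ S, 0 < (q i).toReal := fun i hi =>
    ENNReal.toReal_pos (hq i).ne' (by simpa [hS] using hi)
  have hsum : ∑ i ∈ S, w * ρ / (q i).toReal = 1 := by
    have h1 : ρ⁻¹ = ∑ i, w * ((q i).toReal)⁻¹ := by
      have := congrArg ENNReal.toReal hr
      rw [ENNReal.toReal_inv, ENNReal.toReal_sum] at this
      · simpa [ENNReal.toReal_ofReal hw.le] using this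
      · intro i _
        exact ENNReal.mul_ne_top ENNReal.ofReal_ne_top (ENNReal.inv_ne_top.2 (hq i).ne')
    have h2 : ∑ i, w * ((q i).toReal)⁻¹ = ∑ i ∈ S, w * ((q i).toReal)⁻¹ := by
      symm
      refine Finset.sum_subset (Finset.subset_univ _) fun i _ hi => ?_
      have : q i = ∞ := by simpa [hS] using hi
      simp [this]
    rw [h2] at h1
    calc ∑ i ∈ S, w * ρ / (q i).toReal = ρ * ∑ i ∈ S, w * ((q i).toReal)⁻¹ := by
          rw [Finset.mul_sum]; refine Finset.sum_congr rfl fun i _ => ?_; ring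
      _ = 1 := by rw [← h1]; exact mul_inv_cancel₀ hρ0.ne'
  set C : ℝ≥0∞ := ∏ i ∈ Sᶜ, essSup (g i) ν ^ w with hC
  have hCi : ∀ i ∈ Sᶜ, q i = ∞ := fun i hi => by simpa [hS] using hi
  have hae : ∀ᵐ y ∂ν, (∏ i, g i y ^ w) ^ ρ ≤
      C ^ ρ * ∏ i ∈ S, (g i y ^ (q i).toReal) ^ (w * ρ / (q i).toReal) := by
    have : ∀ᵐ y ∂ν, ∀ i, g i y ≤ essSup (g i) ν :=
      ae_all_iff.2 fun i => ENNReal.ae_le_essSup _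
    filter_upwards [this] with y hy
    rw [← Finset.prod_compl_mul_prod S, ENNReal.mul_rpow_of_nonneg _ _ hρ0.le]
    gcongr ?_ ^ ρ * ?_
    · exact Finset.prod_le_prod' fun i _ => ENNReal.rpow_le_rpow (hy i) hw.le
    · rw [← ENNReal.prod_rpow_of_nonneg hρ0.le]
      refine Finset.prod_le_prod' fun i hi => le_of_eq ?_
      have := hqS i hi
      rw [← ENNReal.rpow_mul, ← ENNReal.rpow_mul]
      congr 1; field_simp
  have hint : ∫⁻ y, (∏ i, g i y ^ w) ^ ρ ∂ν ≤
      C ^ ρ * ∏ i ∈ S, (∫⁻ y, g i y ^ (q i).toReal ∂ν) ^ (w * ρ / (q i).toReal) := by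
    refine (lintegral_mono_ae hae).trans ?_
    rw [lintegral_const_mul _
      (Finset.measurable_fun_prod _ fun i _ => ((hg i).pow_const _).pow_const _)]
    gcongr
    exact ENNReal.lintegral_prod_norm_pow_le S
      (fun i _ => ((hg i).pow_const _).aemeasurable) hsum
      (fun i hi => by have := hqS i hi; positivity)
  rw [eNorm, if_neg hrt, ← hρ]
  refine (ENNReal.rpow_le_rpow hint (by positivity)).trans (le_of_eq ?_)
  rw [ENNReal.mul_rpow_of_nonneg _ _ (by positivity), ← Finset.prod_compl_mul_prod S,
    ← ENNReal.rpow_mul, mul_one_div_cancel hρ0.ne', ENNReal.rpow_one,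
    ← ENNReal.prod_rpow_of_nonneg (by positivity)]
  congr 1
  · refine Finset.prod_congr rfl fun i hi => ?_
    rw [eNorm, if_pos (hCi i hi)]
  · refine Finset.prod_congr rfl fun i hi => ?_
    have := hqS i hi
    rw [eNorm, if_neg (by simpa [hS] using hi), ← ENNReal.rpow_mul, ← ENNReal.rpow_mul]
    congr 1; field_simp
end TwoVar

section ManyVar
variable {n : ℕ} {X : Fin n → Type*} [∀ j, MeasurableSpace (X j)]
  (μ : ∀ j, Measure (X j))

/-- iterated norms -/
noncomputable def foldNorm (P : List (Fin n × ℝ≥0∞))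
    (f : (∀ k, X k) → ℝ≥0∞) : (∀ k, X k) → ℝ≥0∞ :=
  P.foldl (fun g jq => normIn μ jq.1 jq.2 g) f

lemma foldNorm_cons (a : Fin n × ℝ≥0∞) (P : List (Fin n × ℝ≥0∞)) (f : (∀ k, X k) → ℝ≥0∞) :
    foldNorm μ (a :: P) f = foldNorm μ P (normIn μ a.1 a.2 f) := rfl

lemma foldNorm_append (P Q : List (Fin n × ℝ≥0∞)) (f : (∀ k, X k) → ℝ≥0∞) :
    foldNorm μ (P ++ Q) f = foldNorm μ Q (foldNorm μ P f) := List.foldl_append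

lemma normIn_mono (j : Fin n) (q : ℝ≥0∞) {f g : (∀ k, X k) → ℝ≥0∞} (h : f ≤ g) :
    normIn μ j q f ≤ normIn μ j q g := fun _ =>
  eNorm_mono_ae (Filter.Eventually.of_forall fun _ => h _)

lemma foldNorm_mono (P : List (Fin n × ℝ≥0∞)) {f g : (∀ k, X k) → ℝ≥0∞} (h : f ≤ g) :
    foldNorm μ P f ≤ foldNorm μ P g := by
  induction P generalizing f g with
  | nil => exact h
  | cons a P ih => exact ih (normIn_mono μ _ _ h)

variable [∀ j, SigmaFinite (μ j)]

lemma measurable_normIn (j : Fin n) (q : ℝ≥0∞) {f : (∀ k, X k) → ℝ≥0∞} (h : Measurable f) :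
    Measurable (normIn μ j q f) :=
  measurable_eNorm q (F := fun x t => f (Function.update x j t)) (h.comp measurable_update')

lemma normIn_swap {j k : Fin n} (hjk : j ≠ k) {p q : ℝ≥0∞} (hq : 0 < q) (hqp : q ≤ p)
    {f : (∀ k, X k) → ℝ≥0∞} (hf : Measurable f) :
    normIn μ k p (normIn μ j q f) ≤ normIn μ j q (normIn μ k p f) := by
  intro x
  simp only [normIn_eq_eNorm]
  have hm : Measurable (Function.uncurry fun (s : X k) (t : X j) =>
      f (Function.update (Function.update x k s) j t)) := by
    refine hf.comp ?_
    exact measurable_update'.comp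
      (((measurable_update x).comp measurable_fst).prodMk measurable_snd)
  have := eNorm_swap (μ := μ k) (ν := μ j) hm hq hqp
  refine this.trans (le_of_eq ?_)
  congr 1; ext t; congr 1; ext s
  rw [Function.update_comm hjk]

lemma normIn_push (a : Fin n × ℝ≥0∞) (s : List (Fin n × ℝ≥0∞))
    (hs : ∀ b ∈ s, b.1 ≠ a.1 ∧ 0 < b.2 ∧ b.2 ≤ a.2)
    {f : (∀ k, X k) → ℝ≥0∞} (hf : Measurable f) :
    normIn μ a.1 a.2 (foldNorm μ s f) ≤ foldNorm μ s (normIn μ a.1 a.2 f) := by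
  induction s generalizing f with
  | nil => exact le_rfl
  | cons b s ih =>
    have hb := hs b List.mem_cons_self
    simp only [foldNorm_cons]
    refine (ih (fun c hc => hs c (List.mem_cons_of_mem _ hc)) (measurable_normIn μ _ _ hf)).trans ?_
    exact foldNorm_mono μ s (normIn_swap μ hb.1 hb.2.1 hb.2.2 hf)

lemma foldNorm_sort (L L' : List (Fin n × ℝ≥0∞)) (hperm : L'.Perm L)
    (hsort : L.Pairwise (fun a b => b.1 ≠ a.1 ∧ b.2 ≤ a.2)) (hpos : ∀ b ∈ L, 0 < b.2)
    {f : (∀ k, X k) → ℝ≥0∞} (hf : Measurable f) :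
    foldNorm μ L' f ≤ foldNorm μ L f := by
  induction L generalizing L' f with
  | nil => rw [hperm.eq_nil]
  | cons a L ih =>
    obtain ⟨s, t, rfl⟩ := List.append_of_mem (hperm.symm.subset List.mem_cons_self)
    have hst : (s ++ t).Perm L := (List.perm_middle.symm.trans hperm).cons_inv
    rw [List.pairwise_cons] at hsort
    calc foldNorm μ (s ++ a :: t) f = foldNorm μ t (normIn μ a.1 a.2 (foldNorm μ s f)) := by
          rw [foldNorm_append, foldNorm_cons]
      _ ≤ foldNorm μ t (foldNorm μ s (normIn μ a.1 a.2 f)) := by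
          refine foldNorm_mono μ t (normIn_push μ a s (fun b hb => ?_) hf)
          have hbL : b ∈ L := hst.subset (List.mem_append_left _ hb)
          exact ⟨(hsort.1 b hbL).1, hpos b (List.mem_cons_of_mem _ hbL), (hsort.1 b hbL).2⟩
      _ = foldNorm μ (s ++ t) (normIn μ a.1 a.2 f) := by rw [foldNorm_append]
      _ ≤ foldNorm μ L (normIn μ a.1 a.2 f) :=
          ih _ hst hsort.2 (fun b hb => hpos b (List.mem_cons_of_mem _ hb))
            (measurable_normIn μ _ _ hf)

lemma foldNorm_holder {ι : Type*} [Fintype ι] {r : ℝ≥0∞} {q : ι → Fin n → ℝ≥0∞} {w : ℝ}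
    (hw : 0 < w) (hq : ∀ i v, 0 < q i v) (hr0 : 0 < r)
    (hr : ∀ v, r⁻¹ = ∑ i, ENNReal.ofReal w * (q i v)⁻¹) (L : List (Fin n))
    {g : ι → (∀ k, X k) → ℝ≥0∞} (hg : ∀ i, Measurable (g i)) :
    foldNorm μ (L.map fun v => (v, r)) (fun x => ∏ i, g i x ^ w) ≤
      fun x => ∏ i, foldNorm μ (L.map fun v => (v, q i v)) (g i) x ^ w := by
  induction L generalizing g with
  | nil => exact le_rfl
  | cons v L ih =>
    simp only [List.map_cons, foldNorm_cons]
    refine le_trans (foldNorm_mono μ _ ?_) (ih fun i => measurable_normIn μ v (q i v) (hg i))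
    intro x
    exact eNorm_holder (g := fun i t => g i (Function.update x v t)) hw (fun i => hq i v) hr0
      (hr v) (fun i => (hg i).comp (measurable_update x))

lemma foldNorm_eq_lmarginal {r : ℝ≥0∞} (hr0 : 0 < r) (hr : r ≠ ∞) (L : List (Fin n))
    (hL : L.Nodup) {f : (∀ k, X k) → ℝ≥0∞} (hf : Measurable f) :
    foldNorm μ (L.map fun v => (v, r)) f =
      fun x => (∫⋯∫⁻_L.toFinset, (fun x => f x ^ r.toReal) ∂μ) x ^ (1 / r.toReal) := by
  have hρ : r.toReal ≠ 0 := (ENNReal.toReal_pos hr0.ne' hr).ne'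
  induction L generalizing f with
  | nil =>
    ext x
    simp only [List.map_nil, foldNorm, List.foldl_nil, List.toFinset_nil, lmarginal_empty]
    rw [← ENNReal.rpow_mul, mul_one_div_cancel hρ, ENNReal.rpow_one]
  | cons v L ih =>
    rw [List.nodup_cons] at hL
    simp only [List.map_cons, foldNorm_cons]
    rw [ih hL.2 (measurable_normIn μ _ _ hf), List.toFinset_cons,
      lmarginal_insert' _ (hf.pow_const _) (by simpa using hL.1)]
    ext x
    congr 3
    ext y
    simp only [normIn, if_neg hr]
    rw [← ENNReal.rpow_mul, one_div_mul_cancel hρ, ENNReal.rpow_one]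

lemma ae_le_normIn_top (j : Fin n) {f : (∀ k, X k) → ℝ≥0∞} (hf : Measurable f) :
    f ≤ᵐ[Measure.pi μ] normIn μ j ∞ f := by
  have hm := measurable_normIn μ j ∞ hf
  set A : Set (∀ k, X k) := {x | normIn μ j ∞ f x < f x} with hA
  have hAm : MeasurableSet A := measurableSet_lt hm hf
  have h0 : Measure.pi μ A = 0 := by
    by_cases hne : Nonempty (∀ k, X k)
    · obtain ⟨x₀⟩ := hne
      rw [← lintegral_indicator_one hAm]
      have h1 := lmarginal_erase' (μ := μ) (A.indicator 1) (measurable_one.indicator hAm)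
        (Finset.mem_univ j)
      rw [lmarginal_univ] at h1
      have h2 := congrFun h1 x₀
      rw [h2]
      have h3 : (fun x ↦ ∫⁻ t, A.indicator (1 : (∀ k, X k) → ℝ≥0∞) (Function.update x j t) ∂μ j)
          = fun _ => 0 := by
        ext x
        refine (lintegral_congr_ae (g := fun _ => 0) ?_).trans lintegral_zero
        have h4 := ENNReal.ae_le_essSup (μ := μ j) (fun t => f (Function.update x j t))
        filter_upwards [h4] with t ht
        refine Set.indicator_of_notMem ?_ _
        simp only [hA, Set.mem_ofPred_eq, not_lt]
        simpa [normIn] using ht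
      rw [h3]
      simp [lmarginal]
    · have : A = ∅ := Set.eq_empty_of_forall_notMem fun x _ => hne ⟨x⟩
      simp [this]
  change ∀ᵐ x ∂(Measure.pi μ), f x ≤ normIn μ j ∞ f x
  rw [ae_iff]
  simpa [hA] using h0

lemma ae_le_foldNorm_top (L : List (Fin n)) {f : (∀ k, X k) → ℝ≥0∞} (hf : Measurable f) :
    f ≤ᵐ[Measure.pi μ] foldNorm μ (L.map fun v => (v, ∞)) f := by
  induction L generalizing f with
  | nil => exact Filter.EventuallyLE.refl _ _
  | cons v L ih =>
    exact (ae_le_normIn_top μ v hf).trans (ih (measurable_normIn μ _ _ hf))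

lemma eNorm_pi_le {r : ℝ≥0∞} (hr0 : 0 < r) {f : (∀ k, X k) → ℝ≥0∞} (hf : Measurable f) :
    eNorm (Measure.pi μ) r f ≤ ⨆ x, foldNorm μ ((List.finRange n).map fun v => (v, r)) f x := by
  by_cases hr : r = ∞
  · subst hr
    rw [eNorm, if_pos rfl]
    refine essSup_le_of_ae_le _ ?_
    filter_upwards [ae_le_foldNorm_top μ (List.finRange n) hf] with x hx
    exact hx.trans (le_iSup (foldNorm μ ((List.finRange n).map fun v => (v, ∞)) f) x)
  · have hρ : 0 < r.toReal := ENNReal.toReal_pos hr0.ne' hr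
    rw [eNorm, if_neg hr, foldNorm_eq_lmarginal μ hr0 hr _ (List.nodup_finRange n) hf]
    by_cases hne : Nonempty (∀ k, X k)
    · have hu : (List.finRange n).toFinset = Finset.univ := by ext; simp
      simp [hu]
    · rw [not_nonempty_iff] at hne
      rw [lintegral_of_isEmpty, ENNReal.zero_rpow_of_pos (by positivity)]
      exact zero_le

end ManyVar

lemma sum_enum {n m : ℕ} (p : Fin n → ℝ≥0∞) (hp : ∀ j, 0 < p j)
    (e : Fin m → Equiv.Perm (Fin n))
    (henum : ∀ σ : Equiv.Perm (Fin n),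
      ∃! i : Fin m, (fun v => p ((e i)⁻¹ v)) = (fun v => p (σ⁻¹ v))) (v : Fin n) :
    (n : ℝ≥0∞) * ∑ i, (p ((e i)⁻¹ v))⁻¹ = m * ∑ j, (p j)⁻¹ := by
  have hinj : ∀ i i', (fun v => p ((e i)⁻¹ v)) = (fun v => p ((e i')⁻¹ v)) → i = i' :=
    fun i i' h => (henum (e i')).unique h rfl
  have hconst : ∀ u, ∑ i, (p ((e i)⁻¹ u))⁻¹ = ∑ i, (p ((e i)⁻¹ v))⁻¹ := by
    intro u
    let τ : Equiv.Perm (Fin n) := Equiv.swap u v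
    choose c hc using fun i => (henum (τ * e i)).exists
    have hci : Function.Injective c := by
      intro i i' h
      apply hinj
      have h1 := (hc i).symm.trans (h ▸ hc i')
      ext1 x
      have := congrFun h1 (τ x)
      simpa [mul_inv_rev] using this
    have hcb : Function.Bijective c := Finite.injective_iff_bijective.1 hci
    symm
    rw [← (Equiv.ofBijective c hcb).sum_comp]
    refine Finset.sum_congr rfl fun i _ => ?_
    have := congrFun (hc i) v
    simp only [Equiv.ofBijective_apply]
    rw [this]
    simp [mul_inv_rev, τ]
  calc (n : ℝ≥0∞) * ∑ i, (p ((e i)⁻¹ v))⁻¹ = ∑ u : Fin n, ∑ i, (p ((e i)⁻¹ u))⁻¹ := by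
        rw [Finset.sum_congr rfl fun u _ => hconst u]; simp
    _ = ∑ i : Fin m, ∑ u, (p ((e i)⁻¹ u))⁻¹ := Finset.sum_comm
    _ = ∑ i : Fin m, ∑ j, (p j)⁻¹ :=
        Finset.sum_congr rfl fun i _ => Equiv.sum_comp ((e i)⁻¹) fun j => (p j)⁻¹
    _ = m * ∑ j, (p j)⁻¹ := by simp

/-- Symmetric geometric-mean estimate, variables permuted: with `p₁ ≥ ⋯ ≥ pₙ` and
`P₁, …, P_m` (given by permutations `e 1, …, e m` of the variables, the exponents
staying in decreasing order) enumerating the orbit `{P_σ : σ ∈ Sₙ}` modulo the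
identification of tuples assigning the same exponent to each variable (i.e. `P_σ` is
identified with `P_ρ` exactly when `p ∘ σ⁻¹ = p ∘ ρ⁻¹`), for the harmonic mean `p̄`
of the exponents, `‖f‖_{L^{p̄}} ≤ ∏ ‖f‖_{Pᵢ}^{1/m}`: the `L^{p̄}` norm of `f` is at
most the geometric mean of its symmetric mixed norms. -/
theorem symmetric_holder_minkowski_one_function {n m : ℕ} {X : Fin n → Type*}
    [∀ j, MeasurableSpace (X j)] (μ : ∀ j, Measure (X j)) [∀ j, SigmaFinite (μ j)]
    (p : Fin n → ℝ≥0∞) (hp : ∀ j, 0 < p j)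
    (hdecr : ∀ i j : Fin n, i ≤ j → p j ≤ p i)
    (e : Fin m → Equiv.Perm (Fin n))
    (henum : ∀ σ : Equiv.Perm (Fin n),
      ∃! i : Fin m, (fun v => p ((e i)⁻¹ v)) = (fun v => p (σ⁻¹ v)))
    (f : (∀ k, X k) → ℝ≥0∞) (hf : Measurable f) :
    eNorm (Measure.pi μ) ((↑n)⁻¹ * ∑ j : Fin n, (p j)⁻¹)⁻¹ f ≤
      ∏ i : Fin m,
        mixedNorm μ (List.ofFn fun j => (e i j, p j)) f ^ ((1 : ℝ) / m) := by
  classical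
  have hm : 0 < m := by
    obtain ⟨i, _⟩ := (henum 1).exists
    exact i.pos
  have hmR : (0 : ℝ) < m := by exact_mod_cast hm
  have hw : (0 : ℝ) < 1 / m := by positivity
  set r : ℝ≥0∞ := ((↑n)⁻¹ * ∑ j : Fin n, (p j)⁻¹)⁻¹ with hr
  have hr0 : 0 < r := by
    rw [hr, ENNReal.inv_pos]
    rcases Nat.eq_zero_or_pos n with rfl | hn
    · simp
    · refine ENNReal.mul_ne_top (by simp [hn.ne']) ?_
      exact ENNReal.sum_ne_top.2 fun j _ => ENNReal.inv_ne_top.2 (hp j).ne'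
  have hof : ENNReal.ofReal (1 / (m : ℝ)) = (m : ℝ≥0∞)⁻¹ := by
    rw [one_div, ENNReal.ofReal_inv_of_pos hmR, ENNReal.ofReal_natCast]
  have hrv : ∀ v, r⁻¹ = ∑ i, ENNReal.ofReal (1 / (m : ℝ)) * (p ((e i)⁻¹ v))⁻¹ := by
    intro v
    have hn : 0 < n := v.pos
    have h := sum_enum p hp e henum v
    rw [hr, inv_inv, ← Finset.mul_sum, hof]
    have hn0 : (n : ℝ≥0∞) ≠ 0 := by exact_mod_cast hn.ne'
    have hm0 : (m : ℝ≥0∞) ≠ 0 := by exact_mod_cast hm.ne'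
    calc (n : ℝ≥0∞)⁻¹ * ∑ j, (p j)⁻¹
        = (n : ℝ≥0∞)⁻¹ * ((m : ℝ≥0∞)⁻¹ * (m * ∑ j, (p j)⁻¹)) := by
          rw [← mul_assoc (m : ℝ≥0∞)⁻¹, ENNReal.inv_mul_cancel hm0 (ENNReal.natCast_ne_top m),
            one_mul]
      _ = (n : ℝ≥0∞)⁻¹ * n * ((m : ℝ≥0∞)⁻¹ * ∑ i, (p ((e i)⁻¹ v))⁻¹) := by
          rw [← h]; ring
      _ = _ := by
          rw [ENNReal.inv_mul_cancel hn0 (ENNReal.natCast_ne_top n), one_mul]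
  refine (eNorm_pi_le μ hr0 hf).trans (iSup_le fun x => ?_)
  have hfe : f = fun x => ∏ _i : Fin m, f x ^ ((1 : ℝ) / m) := by
    ext x
    rw [Finset.prod_const, Finset.card_univ, Fintype.card_fin, ← ENNReal.rpow_natCast,
      ← ENNReal.rpow_mul, one_div_mul_cancel hmR.ne', ENNReal.rpow_one]
  have hH := foldNorm_holder μ (q := fun i v => p ((e i)⁻¹ v)) hw (fun i v => hp _) hr0 hrv
    (List.finRange n) (g := fun _ => f) (fun _ => hf) x
  rw [← hfe] at hH
  refine hH.trans (Finset.prod_le_prod' fun i _ => ENNReal.rpow_le_rpow ?_ hw.le)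
  have hlist : (List.ofFn fun j => (e i j, p j)) =
      (List.ofFn (e i)).map (fun v => (v, p ((e i)⁻¹ v))) := by
    rw [List.map_ofFn]; congr 1; ext j <;> simp
  have hperm : ((List.finRange n).map fun v => (v, p ((e i)⁻¹ v))).Perm
      (List.ofFn fun j => (e i j, p j)) := by
    rw [hlist]
    refine List.Perm.map _ ?_
    rw [List.perm_ext_iff_of_nodup (List.nodup_finRange n)
      (List.nodup_ofFn.2 (e i).injective)]
    intro a
    simp only [List.mem_finRange, List.mem_ofFn, true_iff]
    exact (e i).surjective a
  refine (foldNorm_sort μ _ _ hperm ?_ ?_ hf x).trans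
    (le_iSup (foldNorm μ (List.ofFn fun j => (e i j, p j)) f) x)
  · rw [List.pairwise_ofFn]
    intro a b hab
    exact ⟨fun h => hab.ne' ((e i).injective h), hdecr _ _ hab.le⟩
  · intro b hb
    obtain ⟨j, rfl⟩ := List.mem_ofFn.1 hb
    exact hp j
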